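/- Let S = {|S_1⟩, |S_2⟩, |S_3⟩, |S_4⟩} be a three-qubit unextendible product basis on qubits A, B, C and H_S its span. If a nonzero vector in H_S factorizes across the bipartite cut A|BC, i.e. equals |Ψ_A⟩⊗|Ψ_BC⟩ for some |Ψ_A⟩ ∈ ℂ² and |Ψ_BC⟩ ∈ ℂ²⊗ℂ², then it is a scalar multiple of one of the members |S_j⟩. -/

import Mathlib

noncomputable section

open Matrix Finset
open scoped ComplexOrder

/-- one-qubit vectors -/
abbrev V2 := Fin 2 → ℂ
/-- index set of the three-qubit space ℂ²⊗ℂ²⊗ℂ² -/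
abbrev I8 := Fin 2 × Fin 2 × Fin 2
/-- three-qubit vectors -/
abbrev V8 := I8 → ℂ
/-- one-qubit operators -/
abbrev M2 := Matrix (Fin 2) (Fin 2) ℂ
/-- three-qubit operators -/
abbrev M8 := Matrix I8 I8 ℂ

/-- inner product on ℂ², conjugate-linear in the first argument -/
def inner2 (u v : V2) : ℂ := ∑ i, star (u i) * v i

/-- inner product on ℂ²⊗ℂ²⊗ℂ², conjugate-linear in the first argument -/
def inner8 (u v : V8) : ℂ := ∑ p, star (u p) * v p

/-- tensor product |a⟩⊗|b⟩⊗|c⟩ of three one-qubit vectors -/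
def tp3 (a b c : V2) : V8 := fun p => a p.1 * b p.2.1 * c p.2.2

/-- Kronecker (tensor) product X_A⊗X_B⊗X_C of three one-qubit operators -/
def kron3 (X Y Z : M2) : M8 :=
  Matrix.of fun p q => X p.1 q.1 * Y p.2.1 q.2.1 * Z p.2.2 q.2.2

/-- a product operator on three qubits -/
def IsProductOp (X : M8) : Prop := ∃ XA XB XC : M2, X = kron3 XA XB XC

/-- the projector |v⟩⟨v| onto a vector -/
def proj8 (v : V8) : M8 := Matrix.vecMulVec v (star v)

/-- A three-qubit unextendible product basis with `n` members: mutually orthonormal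
product vectors (products of unit vectors) such that the orthogonal complement of
their span contains no nonzero product vector. -/
structure UPB (n : ℕ) where
  S : Fin n → V8
  prod : ∀ j, ∃ a b c : V2,
    inner2 a a = 1 ∧ inner2 b b = 1 ∧ inner2 c c = 1 ∧ S j = tp3 a b c
  ortho : ∀ i j, inner8 (S i) (S j) = if i = j then 1 else 0
  unext : ∀ a b c : V2, (∀ j, inner8 (S j) (tp3 a b c) = 0) → tp3 a b c = 0

/-- the bound entangled state ρ_S = (1/(8-n))(I - Σ_j |S_j⟩⟨S_j|) associated with a UPB -/
def upbState {n : ℕ} (U : UPB n) : M8 :=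
  ((8 : ℂ) - (n : ℂ))⁻¹ • ((1 : M8) - ∑ j, proj8 (U.S j))

/-- equivalence of four-member UPBs: related by local unitaries and a permutation of members -/
def UPB.Equiv (S T : UPB 4) : Prop :=
  ∃ UA UB UC : M2, UA ∈ Matrix.unitaryGroup (Fin 2) ℂ ∧
    UB ∈ Matrix.unitaryGroup (Fin 2) ℂ ∧ UC ∈ Matrix.unitaryGroup (Fin 2) ℂ ∧
    ∃ σ : Equiv.Perm (Fin 4), ∀ j, S.S j = (kron3 UA UB UC).mulVec (T.S (σ j))

/-- the positive semidefinite square root of a positive semidefinite matrix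
(the former Mathlib definition `Matrix.PosSemidef.sqrt`, since removed) -/
def Matrix.PosSemidef.sqrt {n 𝕜 : Type*} [Fintype n] [RCLike 𝕜] [DecidableEq n]
    {A : Matrix n n 𝕜} (hA : A.PosSemidef) : Matrix n n 𝕜 :=
  hA.1.eigenvectorUnitary.1 * Matrix.diagonal ((↑) ∘ Real.sqrt ∘ hA.1.eigenvalues) *
    (star hA.1.eigenvectorUnitary : Matrix n n 𝕜)

/-- square root of a positive semidefinite matrix (junk value 0 otherwise) -/
def msqrt {m : Type*} [Fintype m] [DecidableEq m] (A : Matrix m m ℂ) : Matrix m m ℂ :=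
  open scoped Classical in if h : A.PosSemidef then h.sqrt else 0

/-- fidelity F(ρ,σ) = tr √(√ρ σ √ρ) of positive semidefinite matrices -/
def fidelity {m : Type*} [Fintype m] [DecidableEq m] (ρ σ : Matrix m m ℂ) : ℝ :=
  ((msqrt (msqrt ρ * σ * msqrt ρ)).trace).re

/-- tensor product across the bipartite cut A|BC -/
def tpCut (a : V2) (w : Fin 2 × Fin 2 → ℂ) : V8 := fun p => a p.1 * w p.2

/-- the determinant of two one-qubit vectors; it vanishes exactly when they are parallel -/
def det2 (u v : V2) : ℂ := u 0 * v 1 - u 1 * v 0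

/-- a vector orthogonal to `u` -/
def perp2 (u : V2) : V2 := ![-star (u 1), star (u 0)]

lemma inner2_perp2 (u v : V2) : inner2 v (perp2 u) = star (det2 u v) := by
  simp [inner2, perp2, det2, Fin.sum_univ_two]
  ring

lemma inner2_perp2_perp2 (u : V2) : inner2 (perp2 u) (perp2 u) = inner2 u u := by
  simp [inner2, perp2, Fin.sum_univ_two]
  ring

lemma det2_self (u : V2) : det2 u u = 0 := by
  simp [det2, mul_comm]

lemma star_inner2 (u v : V2) : star (inner2 u v) = inner2 v u := by
  simp [inner2, Fin.sum_univ_two, mul_comm]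

lemma inner2_mul_inner2_add_det2 (u v : V2) :
    inner2 u v * inner2 v u + det2 u v * star (det2 u v) = inner2 u u * inner2 v v := by
  simp [inner2, det2, Fin.sum_univ_two]
  ring

lemma inner8_tp3 (a b c a' b' c' : V2) :
    inner8 (tp3 a b c) (tp3 a' b' c') = inner2 a a' * inner2 b b' * inner2 c c' := by
  simp [inner8, tp3, inner2, Fin.sum_univ_two, Fintype.sum_prod_type]
  ring

/-- two vectors orthogonal to a common unit vector are parallel -/
lemma det2_eq_zero_of_inner2_eq_zero {u v w : V2} (hu : inner2 u u = 1)
    (hv : inner2 u v = 0) (hw : inner2 u w = 0) : det2 v w = 0 := by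
  simp only [inner2, Fin.sum_univ_two] at hu hv hw
  simp only [det2]
  linear_combination (-(v 0 * w 1 - v 1 * w 0)) * hu + (u 0 * w 1 - u 1 * w 0) * hv +
    (u 1 * v 0 - u 0 * v 1) * hw

/-- two vectors parallel to a common nonzero vector are parallel -/
lemma det2_eq_zero_of_parallel {a u v : V2} (ha : a ≠ 0)
    (hu : det2 a u = 0) (hv : det2 a v = 0) : det2 u v = 0 := by
  simp only [det2] at hu hv ⊢
  by_contra h
  apply ha
  ext i
  fin_cases i
  · exact (mul_eq_zero.mp (by linear_combination u 0 * hv - v 0 * hu :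
      a 0 * (u 0 * v 1 - u 1 * v 0) = 0)).resolve_right h
  · exact (mul_eq_zero.mp (by linear_combination u 1 * hv - v 1 * hu :
      a 1 * (u 0 * v 1 - u 1 * v 0) = 0)).resolve_right h

/-- If no nonzero product vector is orthogonal to all four product vectors, then no two of
them have parallel factors on a given qubit. -/
lemma det2_ne_zero_of_unextendible {a b c : Fin 4 → V2}
    (ha : ∀ j, inner2 (a j) (a j) = 1) (hb : ∀ j, inner2 (b j) (b j) = 1)
    (hc : ∀ j, inner2 (c j) (c j) = 1)
    (hext : ∀ x y z : V2,
      (∀ j, inner2 (a j) x * inner2 (b j) y * inner2 (c j) z = 0) →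
      inner2 x x * inner2 y y * inner2 z z = 0)
    {i j : Fin 4} (hij : i ≠ j) : det2 (a i) (a j) ≠ 0 := by
  intro h
  obtain ⟨k, l, hkl⟩ : ∃ k l : Fin 4, ∀ m, m = i ∨ m = j ∨ m = k ∨ m = l := by
    clear h
    revert i j
    decide
  have h0 := hext (perp2 (a i)) (perp2 (b k)) (perp2 (c l)) (by
    intro m
    simp only [inner2_perp2]
    rcases hkl m with rfl | rfl | rfl | rfl <;> simp [det2_self, h])
  simp [inner2_perp2_perp2, ha, hb, hc] at h0

/-- Lagrange identity for unit vectors -/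
lemma normSq_inner2_add_normSq_det2 {u v : V2} (hu : inner2 u u = 1) (hv : inner2 v v = 1) :
    Complex.normSq (inner2 u v) + Complex.normSq (det2 u v) = 1 := by
  have h := inner2_mul_inner2_add_det2 u v
  rw [← star_inner2 u v, hu, hv, Complex.star_def, Complex.mul_conj,
    Complex.mul_conj] at h
  exact_mod_cast h.trans (one_mul 1)

/-- A product of two overlaps of unit vectors has modulus less than one as soon as the first
two vectors are not parallel. -/
lemma overlap_mul_overlap_ne_one {b b' c c' : V2} (hb : inner2 b b = 1)
    (hb' : inner2 b' b' = 1) (hc : inner2 c c = 1) (hc' : inner2 c' c' = 1)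
    (h : det2 b b' ≠ 0) :
    (inner2 b b' * inner2 c c') * (inner2 b' b * inner2 c' c) ≠ 1 := by
  have h1 := normSq_inner2_add_normSq_det2 hb hb'
  have h2 := normSq_inner2_add_normSq_det2 hc hc'
  have h3 := Complex.normSq_pos.mpr h
  rw [← star_inner2 b b', ← star_inner2 c c', ← star_mul', Complex.star_def, Complex.mul_conj,
    Complex.normSq_mul]
  intro h4
  norm_cast at h4
  nlinarith [Complex.normSq_nonneg (inner2 b b'), Complex.normSq_nonneg (inner2 c c'),
    Complex.normSq_nonneg (det2 c c')]

/-- The `BC` parts of four pairwise orthogonal product vectors with pairwise nonparallel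
factors on `A` and on `B` are linearly independent. -/
lemma coeff_eq_zero_of_sum_eq_zero {a b c : Fin 4 → V2}
    (ha : ∀ j, inner2 (a j) (a j) = 1) (hb : ∀ j, inner2 (b j) (b j) = 1)
    (hc : ∀ j, inner2 (c j) (c j) = 1)
    (hort : ∀ i j, i ≠ j →
      inner2 (a i) (a j) * inner2 (b i) (b j) * inner2 (c i) (c j) = 0)
    (hda : ∀ i j, i ≠ j → det2 (a i) (a j) ≠ 0)
    (hdb : ∀ i j, i ≠ j → det2 (b i) (b j) ≠ 0)
    (d : Fin 4 → ℂ) (hd : ∀ q r : Fin 2, ∑ j, d j * (b j q * c j r) = 0) (i : Fin 4) :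
    d i = 0 := by
  have gram (i : Fin 4) : ∑ j, d j * (inner2 (b i) (b j) * inner2 (c i) (c j)) = 0 := by
    have h00 := hd 0 0
    have h01 := hd 0 1
    have h10 := hd 1 0
    have h11 := hd 1 1
    simp only [inner2, Fin.sum_univ_two, Fin.sum_univ_four] at *
    linear_combination star (b i 0) * star (c i 0) * h00 + star (b i 0) * star (c i 1) * h01 +
      star (b i 1) * star (c i 0) * h10 + star (b i 1) * star (c i 1) * h11
  have overlap {i j k : Fin 4} (hij : inner2 (a i) (a j) = 0) (hjk : j ≠ k) (hik : i ≠ k) :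
      inner2 (b i) (b k) * inner2 (c i) (c k) = 0 := by
    have h := hort i k hik
    rw [mul_assoc] at h
    exact (mul_eq_zero.mp h).resolve_left fun hk =>
      hda j k hjk (det2_eq_zero_of_inner2_eq_zero (ha i) hij hk)
  have row {i j : Fin 4} (hne : i ≠ j) (hij : inner2 (a i) (a j) = 0) :
      d i + d j * (inner2 (b i) (b j) * inner2 (c i) (c j)) = 0 := by
    have h := gram i
    rw [Fintype.sum_eq_add i j hne fun k hk => by
      rw [overlap hij hk.2.symm hk.1.symm, mul_zero]] at h
    simpa [hb, hc] using h
  by_cases hex : ∃ j, i ≠ j ∧ inner2 (a i) (a j) = 0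
  · obtain ⟨j, hne, hij⟩ := hex
    have hji : inner2 (a j) (a i) = 0 := by rw [← star_inner2, hij, star_zero]
    have h1 := row hne hij
    have h2 := row hne.symm hji
    have h3 := overlap_mul_overlap_ne_one (hb i) (hb j) (hc i) (hc j) (hdb i j hne)
    refine (mul_eq_zero.mp ?_).resolve_right (sub_ne_zero.mpr h3.symm)
    linear_combination h1 - inner2 (b i) (b j) * inner2 (c i) (c j) * h2
  · push Not at hex
    have h := gram i
    rw [Fintype.sum_eq_single i fun k hk => by
      have h := hort i k hk.symm
      rw [mul_assoc] at h
      rw [(mul_eq_zero.mp h).resolve_left (hex k hk.symm), mul_zero]] at h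
    simpa [hb, hc] using h

/-- a nonzero vector in the span of a three-qubit UPB that factorizes
across the bipartite cut A|BC is a scalar multiple of one of the members. -/
theorem stmt5 (S : UPB 4) (v : V8)
    (hv : v ∈ Submodule.span ℂ (Set.range S.S)) (hnz : v ≠ 0)
    (hsplit : ∃ (a : V2) (w : Fin 2 × Fin 2 → ℂ), v = tpCut a w) :
    ∃ (j : Fin 4) (z : ℂ), v = z • S.S j := by
  choose a b c ha hb hc hS using S.prod
  have hort (i j : Fin 4) (hij : i ≠ j) :
      inner2 (a i) (a j) * inner2 (b i) (b j) * inner2 (c i) (c j) = 0 := by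
    rw [← inner8_tp3, ← hS, ← hS, S.ortho, if_neg hij]
  have hext (x y z : V2)
      (h : ∀ j, inner2 (a j) x * inner2 (b j) y * inner2 (c j) z = 0) :
      inner2 x x * inner2 y y * inner2 z z = 0 := by
    rw [← inner8_tp3, S.unext x y z fun j => by rw [hS, inner8_tp3, h]]
    simp [inner8]
  have hda (i j : Fin 4) (hij : i ≠ j) : det2 (a i) (a j) ≠ 0 :=
    det2_ne_zero_of_unextendible ha hb hc hext hij
  have hdb (i j : Fin 4) (hij : i ≠ j) : det2 (b i) (b j) ≠ 0 :=
    det2_ne_zero_of_unextendible hb ha hc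
      (fun y x z h => by
        rw [mul_comm (inner2 y y)]
        exact hext x y z fun j => by rw [mul_comm (inner2 (a j) x), h])
      hij
  obtain ⟨z, rfl⟩ := (Submodule.mem_span_range_iff_exists_fun ℂ).mp hv
  obtain ⟨x, w, hsplit⟩ := hsplit
  have hx : x ≠ 0 := by
    rintro rfl
    exact hnz (hsplit.trans (by ext; simp [tpCut]))
  have hcoord (p q r : Fin 2) : ∑ j, z j * (a j p * b j q * c j r) = x p * w (q, r) := by
    simpa [hS, tp3, tpCut] using congrFun hsplit (p, q, r)
  have hzero := coeff_eq_zero_of_sum_eq_zero ha hb hc hort hda hdb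
    (fun j => z j * det2 x (a j)) (fun q r => by
      have h0 := hcoord 0 q r
      have h1 := hcoord 1 q r
      simp only [det2, Fin.sum_univ_four] at *
      linear_combination x 0 * h1 - x 1 * h0)
  obtain ⟨j, hj⟩ : ∃ j, z j ≠ 0 := by
    by_contra! h
    exact hnz (by simp [h])
  refine ⟨j, z j, Fintype.sum_eq_single j fun k hk => ?_⟩
  have hzk : z k = 0 := by
    by_contra h
    exact hda k j hk (det2_eq_zero_of_parallel hx ((mul_eq_zero.mp (hzero k)).resolve_left h)
      ((mul_eq_zero.mp (hzero j)).resolve_left hj))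
  rw [hzk, zero_smul]
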